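/- Let n ≥ 1, let σ ∈ ℝⁿ with σ_i > 0 for all i, let θ, δ ∈ ℝⁿ, and set r = sqrt( Σ_{i=1}^n δ_i²/σ_i² ) (the Mahalanobis norm of δ with respect to the diagonal covariance diag(σ₁², …, σ_n²)). Let P₀ be the product of Gaussian measures N(θ_i, σ_i²) and P₁ the product of Gaussian measures N(θ_i + δ_i, σ_i²) on ℝⁿ. Then for every p ∈ (0,1) and every measurable test φ : ℝⁿ → [0,1] with ∫ φ dP₀ ≤ 1 − p, it holds that ∫ (1 − φ) dP₁ ≥ Φ(Φ⁻¹(p) − r). -/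

import Mathlib

open MeasureTheory ProbabilityTheory

/-- `Φ`: the cumulative distribution function of the standard Gaussian. -/
noncomputable def stdGaussCDF : ℝ → ℝ := fun x => cdf (gaussianReal 0 1) x

/-- `Φ⁻¹`: the inverse of the standard Gaussian CDF (on `(0,1)`). -/
noncomputable def stdGaussCDFInv : ℝ → ℝ := Function.invFun stdGaussCDF

open scoped ENNReal NNReal

/-- A product of measures with densities has the product of the densities as its density. -/
lemma pi_withDensity_eq_withDensity_prod {ι : Type*} [Fintype ι] {E : ι → Type*}
    {mE : ∀ i, MeasurableSpace (E i)} (μ : ∀ i, Measure (E i)) [∀ i, IsProbabilityMeasure (μ i)]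
    (f : ∀ i, E i → ℝ≥0∞) (hf : ∀ i, Measurable (f i))
    [∀ i, SigmaFinite ((μ i).withDensity (f i))] :
    Measure.pi (fun i => (μ i).withDensity (f i)) =
      (Measure.pi μ).withDensity (fun x => ∏ i, f i (x i)) := by
  refine Measure.pi_eq fun s hs => ?_
  rw [withDensity_apply _ (MeasurableSet.univ_pi hs),
    ← lintegral_indicator (MeasurableSet.univ_pi hs)]
  have hind : ∀ x, (Set.univ.pi s).indicator (fun x => ∏ i, f i (x i)) x
      = ∏ i, (s i).indicator (f i) (x i) := by
    intro x
    by_cases hx : x ∈ Set.univ.pi s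
    · rw [Set.indicator_of_mem hx]
      exact Finset.prod_congr rfl fun i _ => (Set.indicator_of_mem (hx i trivial) _).symm
    · rw [Set.indicator_of_notMem hx]
      obtain ⟨i, hi⟩ : ∃ i, x i ∉ s i := by simpa [Set.mem_pi] using hx
      exact (Finset.prod_eq_zero (Finset.mem_univ i) (Set.indicator_of_notMem hi _)).symm
  have hm : ∀ i, Measurable ((s i).indicator (f i)) := fun i => (hf i).indicator (hs i)
  simp_rw [hind]
  rw [lintegral_prod_eq_prod_lintegral_of_indepFun Finset.univ
    (fun i (x : ∀ i, E i) => (s i).indicator (f i) (x i)) (iIndepFun_pi fun i => (hm i).aemeasurable)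
    fun i => (hm i).comp (measurable_pi_apply i)]
  refine Finset.prod_congr rfl fun i _ => ?_
  rw [withDensity_apply _ (hs i), ← lintegral_indicator (hs i)]
  exact (measurePreserving_eval μ i).lintegral_comp (hm i)

/-- The density of a shifted Gaussian with respect to the original one. -/
lemma gaussianReal_add_eq_withDensity (m d : ℝ) {v : ℝ≥0} (hv : v ≠ 0) :
    gaussianReal (m + d) v = (gaussianReal m v).withDensity
      (fun x => ENNReal.ofReal (Real.exp (d * (x - m) / v - d ^ 2 / (2 * v)))) := by
  rw [gaussianReal_of_var_ne_zero _ hv, gaussianReal_of_var_ne_zero _ hv,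
    ← withDensity_mul _ (measurable_gaussianPDF m v) (by fun_prop)]
  congr 1
  ext x
  have hv' : (v : ℝ) ≠ 0 := by exact_mod_cast hv
  simp only [gaussianPDF, Pi.mul_apply]
  rw [← ENNReal.ofReal_mul (gaussianPDFReal_nonneg _ _ _), gaussianPDFReal, gaussianPDFReal,
    mul_assoc (√(2 * Real.pi * v))⁻¹, ← Real.exp_add]
  congr 3
  field_simp
  ring

/-- A linear form in independent Gaussian variables is Gaussian. -/
lemma pi_gaussianReal_map_sum {ι : Type*} [Fintype ι] (m a : ι → ℝ) (v : ι → ℝ≥0) (w : ℝ≥0)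
    (hw : (w : ℝ) = ∑ i, a i ^ 2 * v i) :
    (Measure.pi fun i => gaussianReal (m i) (v i)).map (fun x => ∑ i, a i * x i) =
      gaussianReal (∑ i, a i * m i) w := by
  have hmeas : Measurable (fun x : ι → ℝ => ∑ i, a i * x i) := by fun_prop
  have := Measure.isProbabilityMeasure_map (μ := Measure.pi fun i => gaussianReal (m i) (v i))
    hmeas.aemeasurable
  refine Measure.ext_of_charFun ?_
  ext t
  rw [charFun_gaussianReal, charFun_apply_real, integral_map hmeas.aemeasurable (by fun_prop)]
  have hexp : ∀ x : ι → ℝ, Complex.exp (t * ((∑ i, a i * x i : ℝ) : ℂ) * Complex.I)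
      = ∏ i, Complex.exp (((t * a i : ℝ) : ℂ) * (x i : ℂ) * Complex.I) := by
    intro x
    rw [← Complex.exp_sum]
    congr 1
    push_cast
    rw [Finset.mul_sum, Finset.sum_mul]
    exact Finset.sum_congr rfl fun i _ => by ring
  simp_rw [hexp]
  rw [integral_fintype_prod_eq_prod
    (f := fun i (y : ℝ) => Complex.exp (((t * a i : ℝ) : ℂ) * (y : ℂ) * Complex.I))]
  simp_rw [← charFun_apply_real, charFun_gaussianReal]
  rw [← Complex.exp_sum]
  congr 1
  have hw' : (w : ℂ) = ∑ i, (a i : ℂ) ^ 2 * (v i : ℂ) := by exact_mod_cast congrArg Complex.ofReal hw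
  rw [hw', Finset.sum_sub_distrib]
  push_cast
  simp only [Finset.mul_sum, Finset.sum_mul, Finset.sum_div]
  congr 1 <;> exact Finset.sum_congr rfl fun i _ => by ring

lemma gaussianReal_real_Iic (m c : ℝ) {r : ℝ} (hr : 0 < r) {v : ℝ≥0} (hv : (v : ℝ) = r ^ 2) :
    (gaussianReal m v).real (Set.Iic c) = stdGaussCDF ((c - m) / r) := by
  have hstd : (gaussianReal m v).map (fun x => (x - m) / r) = gaussianReal 0 1 := by
    have h := Measure.map_map (μ := gaussianReal m v) (g := fun x : ℝ => x / r)
      (f := fun x => x - m) (by fun_prop) (by fun_prop)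
    rw [gaussianReal_map_sub_const, gaussianReal_map_div_const] at h
    rw [show (fun x => (x - m) / r) = (fun x : ℝ => x / r) ∘ (fun x => x - m) from rfl, ← h]
    congr 1
    · simp
    · ext
      simp [hv, hr.ne']
  rw [stdGaussCDF, cdf_eq_real, ← hstd, map_measureReal_apply (by fun_prop) measurableSet_Iic]
  congr 1
  ext x
  simp [div_le_div_iff_of_pos_right hr]

lemma continuous_stdGaussCDF : Continuous stdGaussCDF := by
  refine continuous_iff_continuousAt.2 fun x => ?_
  have hmono := monotone_cdf (gaussianReal 0 1)
  have h0 : gaussianReal 0 1 {x} = 0 :=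
    gaussianReal_absolutelyContinuous 0 one_ne_zero Real.volume_singleton
  rw [← measure_cdf (gaussianReal 0 1), StieltjesFunction.measure_singleton,
    ENNReal.ofReal_eq_zero] at h0
  refine hmono.continuousAt_iff_leftLim_eq_rightLim.2 ?_
  rw [StieltjesFunction.rightLim_eq]
  exact le_antisymm (hmono.leftLim_le le_rfl) (by linarith)

lemma stdGaussCDF_stdGaussCDFInv {p : ℝ} (hp : p ∈ Set.Ioo (0 : ℝ) 1) :
    stdGaussCDF (stdGaussCDFInv p) = p := by
  refine Function.invFun_eq (mem_range_of_exists_le_of_exists_ge continuous_stdGaussCDF ?_ ?_)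
  · exact (((tendsto_cdf_atBot (gaussianReal 0 1)).eventually_lt_const hp.1).exists).imp
      fun _ h => h.le
  · exact (((tendsto_cdf_atTop (gaussianReal 0 1)).eventually_const_lt hp.2).exists).imp
      fun _ h => h.le

/-- Neyman–Pearson: among all tests `ψ` with `∫ ψ dμ ≥ μ A`, where `A` is a sublevel set of the
density `L`, the integral against `L dμ` is minimised by the indicator of `A`. -/
lemma measureReal_le_integral_withDensity {Ω : Type*} {mΩ : MeasurableSpace Ω} (μ : Measure Ω)
    [IsFiniteMeasure μ] {L : Ω → ℝ} (hL : Measurable L) (hL0 : ∀ x, 0 ≤ L x)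
    [IsFiniteMeasure (μ.withDensity fun x => ENNReal.ofReal (L x))]
    {k : ℝ} (hk : 0 ≤ k) {A : Set Ω} (hA : MeasurableSet A)
    (hLA : ∀ x ∈ A, L x ≤ k) (hLA' : ∀ x ∉ A, k ≤ L x)
    {ψ : Ω → ℝ} (hψ : Measurable ψ) (hψ01 : ∀ x, ψ x ∈ Set.Icc (0 : ℝ) 1)
    (h : μ.real A ≤ ∫ x, ψ x ∂μ) :
    (μ.withDensity fun x => ENNReal.ofReal (L x)).real A ≤
      ∫ x, ψ x ∂(μ.withDensity fun x => ENNReal.ofReal (L x)) := by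
  set ν := μ.withDensity fun x => ENNReal.ofReal (L x) with hν
  have hψi : ∀ (ρ : Measure Ω) [IsFiniteMeasure ρ], Integrable ψ ρ := fun ρ _ =>
    Integrable.of_bound hψ.aestronglyMeasurable 1 (Filter.Eventually.of_forall fun x => by
      rw [Real.norm_eq_abs, abs_le]; exact ⟨by linarith [(hψ01 x).1], (hψ01 x).2⟩)
  have hAi : ∀ (ρ : Measure Ω) [IsFiniteMeasure ρ], Integrable (A.indicator (1 : Ω → ℝ)) ρ :=
    fun ρ _ => (integrable_const (1 : ℝ)).indicator hA
  have hdiff : ∀ (ρ : Measure Ω) [IsFiniteMeasure ρ],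
      ∫ x, (ψ x - A.indicator 1 x) ∂ρ = ∫ x, ψ x ∂ρ - ρ.real A := fun ρ _ => by
    rw [integral_sub (hψi ρ) (hAi ρ), integral_indicator_one hA]
  have hνint : ∫ x, (ψ x - A.indicator 1 x) ∂ν = ∫ x, L x * (ψ x - A.indicator 1 x) ∂μ := by
    rw [hν, integral_withDensity_eq_integral_toReal_smul (by fun_prop) (by simp)]
    simp [ENNReal.toReal_ofReal (hL0 _)]
  have hi : Integrable (fun x => L x * (ψ x - A.indicator 1 x)) μ := by
    have := (integrable_withDensity_iff_integrable_smul' (μ := μ)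
      (f := fun x => ENNReal.ofReal (L x)) (by fun_prop) (by simp)).1 ((hψi ν).sub (hAi ν))
    simpa [ENNReal.toReal_ofReal (hL0 _)] using this
  have hle : ∫ x, k * (ψ x - A.indicator 1 x) ∂μ ≤ ∫ x, L x * (ψ x - A.indicator 1 x) ∂μ := by
    refine integral_mono (((hψi μ).sub (hAi μ)).const_mul k) hi fun x => ?_
    by_cases hx : x ∈ A
    · simp only [Set.indicator_of_mem hx, Pi.one_apply]
      nlinarith [hLA x hx, (hψ01 x).2]
    · simp only [Set.indicator_of_notMem hx, sub_zero]
      exact mul_le_mul_of_nonneg_right (hLA' x hx) (hψ01 x).1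
  rw [integral_const_mul, hdiff, ← hνint, hdiff] at hle
  nlinarith [mul_nonneg hk (sub_nonneg.2 h)]

/-- for product Gaussians `P₀ = ⊗ N(θᵢ, σᵢ²)` and
`P₁ = ⊗ N(θᵢ + δᵢ, σᵢ²)` with Mahalanobis radius `r = √(Σᵢ δᵢ²/σᵢ²)`, any test
with Type-I error at most `1 - p` under `P₀` has Type-II error at least
`Φ(Φ⁻¹(p) - r)` under `P₁`. -/
theorem stmt_16 (n : ℕ) (hn : 1 ≤ n) (σ θ δ : Fin n → ℝ) (hσ : ∀ i, 0 < σ i)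
    (p : ℝ) (hp : p ∈ Set.Ioo (0 : ℝ) 1)
    (φ : (Fin n → ℝ) → ℝ) (hφ : Measurable φ)
    (hφ01 : ∀ x, φ x ∈ Set.Icc (0 : ℝ) 1)
    (h : ∫ x, φ x ∂(Measure.pi fun i => gaussianReal (θ i) ⟨(σ i) ^ 2, sq_nonneg _⟩)
      ≤ 1 - p) :
    ∫ x, (1 - φ x)
        ∂(Measure.pi fun i => gaussianReal (θ i + δ i) ⟨(σ i) ^ 2, sq_nonneg _⟩)
      ≥ stdGaussCDF (stdGaussCDFInv p - Real.sqrt (∑ i, (δ i) ^ 2 / (σ i) ^ 2)) := by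
  set v : Fin n → ℝ≥0 := fun i => ⟨(σ i) ^ 2, sq_nonneg _⟩ with hv
  have hvc : ∀ i, (v i : ℝ) = σ i ^ 2 := fun i => rfl
  have hv0 : ∀ i, v i ≠ 0 := fun i hi => by
    have := hvc i
    rw [hi] at this
    exact (pow_pos (hσ i) 2).ne this
  change ∫ x, φ x ∂(Measure.pi fun i => gaussianReal (θ i) (v i)) ≤ 1 - p at h
  change _ ≤ ∫ x, (1 - φ x) ∂(Measure.pi fun i => gaussianReal (θ i + δ i) (v i))
  set r := Real.sqrt (∑ i, (δ i) ^ 2 / (σ i) ^ 2) with hr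
  set t := stdGaussCDFInv p
  have ht : stdGaussCDF t = p := stdGaussCDF_stdGaussCDFInv hp
  have hs0 : 0 ≤ ∑ i, (δ i) ^ 2 / (σ i) ^ 2 := Finset.sum_nonneg fun i _ => by positivity
  have hrsq : r ^ 2 = ∑ i, (δ i) ^ 2 / (σ i) ^ 2 := Real.sq_sqrt hs0
  have hφi : Integrable φ (Measure.pi fun i => gaussianReal (θ i) (v i)) :=
    Integrable.of_bound hφ.aestronglyMeasurable 1 (Filter.Eventually.of_forall fun x => by
      rw [Real.norm_eq_abs, abs_le]; exact ⟨by linarith [(hφ01 x).1], (hφ01 x).2⟩)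
  have hpow : p ≤ ∫ x, (1 - φ x) ∂(Measure.pi fun i => gaussianReal (θ i) (v i)) := by
    rw [integral_sub (integrable_const _) hφi]
    simp only [integral_const, probReal_univ, smul_eq_mul, mul_one]
    linarith
  rcases (Real.sqrt_nonneg (∑ i, (δ i) ^ 2 / (σ i) ^ 2)).eq_or_lt with hr0 | hrpos
  · have hδ : ∀ i, δ i = 0 := fun i => by
      have h1 : ∑ i, (δ i) ^ 2 / (σ i) ^ 2 = 0 := by rw [← hrsq, hr, ← hr0]; simp
      have h2 := (Finset.sum_eq_zero_iff_of_nonneg fun i _ => by positivity).1 h1 i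
        (Finset.mem_univ i)
      simpa [(hσ i).ne'] using h2
    rw [hr, ← hr0, sub_zero, ht]
    simpa [hδ] using hpow
  rw [← hr] at hrpos
  set a : Fin n → ℝ := fun i => δ i / σ i ^ 2 with ha
  set X : (Fin n → ℝ) → ℝ := fun x => ∑ i, a i * x i with hX
  have hXm : Measurable X := by fun_prop
  set w : ℝ≥0 := ⟨r ^ 2, sq_nonneg r⟩
  have hwc : (w : ℝ) = r ^ 2 := rfl
  have hw : (w : ℝ) = ∑ i, a i ^ 2 * v i := by
    rw [hwc, hrsq]
    refine Finset.sum_congr rfl fun i _ => ?_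
    have := (hσ i).ne'
    simp only [ha, hvc]
    field_simp
  set M := ∑ i, a i * θ i with hM
  have hM1 : ∑ i, a i * (θ i + δ i) = M + r ^ 2 := by
    rw [hrsq, hM, ← Finset.sum_add_distrib]
    exact Finset.sum_congr rfl fun i _ => by simp only [ha]; ring
  set A : Set (Fin n → ℝ) := X ⁻¹' Set.Iic (M + r * t) with hA
  have hAm : MeasurableSet A := hXm measurableSet_Iic
  have hA0 : (Measure.pi fun i => gaussianReal (θ i) (v i)).real A = p := by
    rw [hA, ← map_measureReal_apply hXm measurableSet_Iic, pi_gaussianReal_map_sum _ _ _ w hw,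
      gaussianReal_real_Iic _ _ hrpos hwc, ← ht]
    congr 1
    field_simp
    ring
  have hA1 : (Measure.pi fun i => gaussianReal (θ i + δ i) (v i)).real A
      = stdGaussCDF (t - r) := by
    rw [hA, ← map_measureReal_apply hXm measurableSet_Iic, pi_gaussianReal_map_sum _ _ _ w hw,
      gaussianReal_real_Iic _ _ hrpos hwc, hM1]
    congr 1
    field_simp
    ring
  have hdens : (Measure.pi fun i => gaussianReal (θ i + δ i) (v i)) =
      (Measure.pi fun i => gaussianReal (θ i) (v i)).withDensity
        (fun x => ENNReal.ofReal (Real.exp (X x - M - r ^ 2 / 2))) := by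
    have hg := fun i => gaussianReal_add_eq_withDensity (θ i) (δ i) (hv0 i)
    have : ∀ i, SigmaFinite ((gaussianReal (θ i) (v i)).withDensity fun x =>
        ENNReal.ofReal (Real.exp (δ i * (x - θ i) / v i - δ i ^ 2 / (2 * v i)))) := fun i => by
      rw [← hg i]; infer_instance
    simp_rw [hg]
    rw [pi_withDensity_eq_withDensity_prod _ _ fun i => by fun_prop]
    congr 1
    ext x
    rw [← ENNReal.ofReal_prod_of_nonneg fun i _ => (Real.exp_pos _).le, ← Real.exp_sum]
    congr 2
    rw [hrsq, hM, hX, Finset.sum_div, ← Finset.sum_sub_distrib, ← Finset.sum_sub_distrib]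
    refine Finset.sum_congr rfl fun i _ => ?_
    have := (hσ i).ne'
    simp only [ha, hvc]
    field_simp
  have hfin : IsFiniteMeasure ((Measure.pi fun i => gaussianReal (θ i) (v i)).withDensity
      (fun x => ENNReal.ofReal (Real.exp (X x - M - r ^ 2 / 2)))) := by
    rw [← hdens]; infer_instance
  rw [← hA1, hdens]
  refine measureReal_le_integral_withDensity _ (by fun_prop) (fun x => (Real.exp_pos _).le)
    (k := Real.exp (r * t - r ^ 2 / 2)) (Real.exp_pos _).le hAm ?_ ?_ (by fun_prop) ?_
    (hA0.trans_le hpow)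
  · intro x hx
    have : X x ≤ M + r * t := hx
    exact Real.exp_le_exp.2 (by linarith)
  · intro x hx
    have : M + r * t < X x := not_le.1 hx
    exact Real.exp_le_exp.2 (by linarith)
  · intro x
    exact ⟨by linarith [(hφ01 x).2], by linarith [(hφ01 x).1]⟩
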